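/- Let k be a positive integer, and for each i ∈ [k] let X_i = (X_i, P^{X_i}, L^{X_i}) and Y_i = (Y_i, P^{Y_i}, L^{Y_i}) be finite sets equipped with a strict partial order and a strict linear order extending it. Then there exist structures Z_i = (Z_i, P^{Z_i}, L^{Z_i}) of the same kind, for i ∈ [k], such that for every 2-coloring of the Cartesian product of the sets of copies, (copies of X_1 in Z_1) × ⋯ × (copies of X_k in Z_k), there exist copies Ỹ_i of Y_i in Z_i for each i ∈ [k] such that the product set (copies of X_1 inside Ỹ_1) × ⋯ × (copies of X_k inside Ỹ_k) is monochromatic. -/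

import Mathlib

/-- `π` is order preserving for the `PL^(1)` structures `(α, P, L)` and `(β, P', L')`. -/
def OrderPres {α β : Type} (P L : α → α → Prop) (P' L' : β → β → Prop)
    (π : α → β) : Prop :=
  (∀ x y, P x y ↔ P' (π x) (π y)) ∧ (∀ x y, L x y ↔ L' (π x) (π y))

/-- `S` is a copy of the `PL^(1)` structure `(α, P, L)` in `(β, P', L')`:
it is the image of an order preserving map. -/
def IsCopy {α β : Type} (P L : α → α → Prop) (P' L' : β → β → Prop)
    (S : Set β) : Prop :=
  ∃ π : α → β, OrderPres P L P' L' π ∧ Set.range π = S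


def RG : ℕ → List ℕ → ℕ → Prop
  | a, [], b => a = b
  | a, l :: w, b => (l < a ∧ RG a w b) ∨ (l = a ∧ RG (a+1) w b)

def sb (a : ℕ) (v : List ℕ) (l : ℕ) : ℕ := if l < a then l else v.getD (l - a) 0

def sh (a : ℕ) (l : ℕ) : ℕ := if l < a then l else l + 1

theorem RG_le : ∀ (w : List ℕ) (a b : ℕ), RG a w b → a ≤ b
  | [], a, b, h => by simp only [RG] at h; omega
  | l :: w, a, b, h => by
    rcases h with ⟨_, h⟩ | ⟨_, h⟩
    · exact RG_le w a b h
    · have := RG_le w _ b h; omega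

theorem RG_lt : ∀ (w : List ℕ) (a b : ℕ), RG a w b → ∀ l ∈ w, l < b
  | [], a, b, h => by simp
  | l :: w, a, b, h => by
    intro x hx
    rcases h with ⟨h1, h⟩ | ⟨h1, h⟩
    · have h2 := RG_le w a b h
      rcases List.mem_cons.1 hx with rfl | hx
      · omega
      · exact RG_lt w a b h x hx
    · have h2 := RG_le w _ b h
      rcases List.mem_cons.1 hx with rfl | hx
      · omega
      · exact RG_lt w _ b h x hx

theorem RG_append : ∀ (u w : List ℕ) (a b c : ℕ), RG a u b → RG b w c → RG a (u ++ w) c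
  | [], w, a, b, c, h, h' => by simp only [RG] at h; subst h; simpa using h'
  | l :: u, w, a, b, c, h, h' => by
    rcases h with ⟨h1, h⟩ | ⟨h1, h⟩
    · exact Or.inl ⟨h1, RG_append u w _ _ _ h h'⟩
    · exact Or.inr ⟨h1, RG_append u w _ _ _ h h'⟩

theorem RG_const : ∀ (w : List ℕ) (a : ℕ), (∀ l ∈ w, l < a) → RG a w a
  | [], a, h => by simp [RG]
  | l :: w, a, h => Or.inl ⟨h l (by simp), RG_const w a fun x hx => h x (by simp [hx])⟩

theorem RG_range' : ∀ (D a : ℕ), RG a (List.range' a D) (a + D)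
  | 0, a => by simp [RG]
  | D+1, a => by
    rw [List.range'_succ]
    refine Or.inr ⟨rfl, ?_⟩
    have := RG_range' D (a+1)
    rwa [show a + 1 + D = a + (D + 1) by omega] at this

theorem RG_comp : ∀ (w : List ℕ) (a b c d : ℕ) (v : List ℕ) (σ : ℕ → ℕ), RG a w b → RG c v d →
    a + v.length = b → (∀ l < a, σ l < c) → (∀ i < v.length, σ (a + i) = v.getD i 0) →
    RG c (w.map σ) d
  | [], a, b, c, d, v, σ, h, hv, hl, h1, h2 => by
    simp only [RG] at h
    have : v = [] := List.length_eq_zero_iff.1 (by omega)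
    subst this
    simpa [RG] using hv
  | l :: w, a, b, c, d, v, σ, h, hv, hl, h1, h2 => by
    rcases h with ⟨h3, h⟩ | ⟨h3, h⟩
    · exact Or.inl ⟨h1 l h3, RG_comp w a b c d v σ h hv hl h1 h2⟩
    · have h4 := RG_le _ _ _ h
      subst h3
      cases v with
      | nil => simp at hl; omega
      | cons x v =>
        have h5 : σ l = x := by simpa using h2 0 (by simp)
        have h6 : ∀ i < v.length, σ (l + 1 + i) = v.getD i 0 := by
          intro i hi
          have := h2 (i+1) (by simpa using hi)
          rw [show l + 1 + i = l + (i + 1) by omega, this]; simp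
        have h7 : l + 1 + v.length = b := by simp at hl; omega
        rcases hv with ⟨h8, hv⟩ | ⟨h8, hv⟩
        · refine Or.inl ⟨by omega, RG_comp w _ b c d v σ h hv h7 ?_ h6⟩
          intro y hy
          rcases Nat.lt_succ_iff_lt_or_eq.1 hy with hy | rfl
          · exact h1 y hy
          · omega
        · refine Or.inr ⟨by omega, RG_comp w _ b _ d v σ h hv h7 ?_ h6⟩
          intro y hy
          rcases Nat.lt_succ_iff_lt_or_eq.1 hy with hy | rfl
          · have := h1 y hy; omega
          · omega

theorem RG_sub (w : List ℕ) (a d : ℕ) (v : List ℕ) (h : RG a w (a + v.length)) (hv : RG a v d) :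
    RG a (w.map (sb a v)) d := by
  refine RG_comp w a _ a d v _ h hv rfl ?_ ?_
  · intro l hl; simp [sb, hl]
  · intro i hi; simp [sb]

theorem RG_shift (a : ℕ) : ∀ (w : List ℕ) (s b : ℕ), RG s w b → a ≤ s →
    RG (s+1) (w.map (sh a)) (b+1)
  | [], s, b, h, ha => by simp only [RG] at h; simp [RG, h]
  | l :: w, s, b, h, ha => by
    rcases h with ⟨h1, h⟩ | ⟨h1, h⟩
    · refine Or.inl ⟨?_, RG_shift a w s b h ha⟩
      unfold sh; split_ifs <;> omega
    · refine Or.inr ⟨?_, RG_shift a w _ b h (by omega)⟩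
      unfold sh; split_ifs <;> omega

theorem sb_sb (a : ℕ) (ha : 0 < a) (u v : List ℕ) (l : ℕ) :
    sb a u (sb a v l) = sb a (v.map (sb a u)) l := by
  by_cases h : l < a
  · simp [sb, h]
  · have h0 : sb a u 0 = 0 := by simp [sb, ha]
    have h1 : ∀ w, sb a w l = w.getD (l - a) 0 := fun w => by simp [sb, h]
    rw [h1, h1]
    conv_rhs => rw [← h0]
    rw [List.getD_map]

theorem sub_assoc (a : ℕ) (ha : 0 < a) (u v w : List ℕ) :
    (w.map (sb a v)).map (sb a u) = w.map (sb a (v.map (sb a u))) := by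
  rw [List.map_map]; exact List.map_congr_left fun l _ => sb_sb a ha u v l

theorem RG_decomp : ∀ (z : List ℕ) (a b : ℕ), RG a z b → a < b →
    ∃ q t, z = q ++ a :: t ∧ (∀ l ∈ q, l < a) ∧ RG (a+1) t b
  | [], a, b, h, hb => by simp only [RG] at h; omega
  | l :: z, a, b, h, hb => by
    rcases h with ⟨h1, h⟩ | ⟨h1, h⟩
    · obtain ⟨q, t, rfl, hq, ht⟩ := RG_decomp z a b h hb
      exact ⟨l :: q, t, rfl, by simpa [h1] using hq, ht⟩
    · exact ⟨[], z, by simp [h1], by simp, h⟩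

theorem RG_eq_const : ∀ (z : List ℕ) (a : ℕ), RG a z a → ∀ l ∈ z, l < a :=
  fun z a h => RG_lt z a a h

/-- prefix before the first letter `a` -/
def tw (a : ℕ) (z : List ℕ) : List ℕ := z.takeWhile (fun l => decide (l < a))

theorem tw_append (a : ℕ) : ∀ (q t : List ℕ), (∀ l ∈ q, l < a) → tw a (q ++ a :: t) = q
  | [], t, h => by simp [tw]
  | l :: q, t, h => by
    have := tw_append a q t (fun x hx => h x (by simp [hx]))
    have h1 := h l (by simp)
    simp only [tw] at this ⊢
    simp [h1, this]

theorem tw_sub_aux (a : ℕ) (e : ℕ) (σ τ : ℕ → ℕ) (h1 : ∀ l < e, σ l = τ l ∧ σ l < a)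
    (h2 : σ e = a) (h3 : τ e = a) : ∀ (u : List ℕ) (s b : ℕ), s ≤ e → RG s u b →
    tw a (u.map σ) = tw a (u.map τ)
  | [], s, b, hs, h => by simp
  | l :: u, s, b, hs, h => by
    rcases h with ⟨h4, h⟩ | ⟨h4, h⟩
    · obtain ⟨h5, h6⟩ := h1 l (by omega)
      have := tw_sub_aux a e σ τ h1 h2 h3 u s b hs h
      simp only [tw] at this ⊢
      simp [← h5, h6, this]
    · by_cases h7 : l = e
      · subst h7
        simp [tw, h2, h3]
      · obtain ⟨h5, h6⟩ := h1 l (by omega)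
        have := tw_sub_aux a e σ τ h1 h2 h3 u _ b (by omega) h
        simp only [tw] at this ⊢
        simp [← h5, h6, this]

theorem tw_sub (a : ℕ) (u p t t' : List ℕ) (b : ℕ) (hp : ∀ l ∈ p, l < a) (h : RG a u b) :
    tw a (u.map (sb a (p ++ a :: t))) = tw a (u.map (sb a (p ++ a :: t'))) := by
  refine tw_sub_aux a (a + p.length) _ _ ?_ ?_ ?_ u a b (by omega) h
  · intro l hl
    by_cases hla : l < a
    · simp [sb, hla]
    · have : l - a < p.length := by omega
      simp only [sb, hla, if_false]
      rw [List.getD_append _ _ _ _ this, List.getD_append _ _ _ _ this]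
      refine ⟨rfl, ?_⟩
      rw [List.getD_eq_getElem _ _ this]
      exact hp _ (List.getElem_mem _)
  · simp [sb]
  · simp [sb]

/-- Hales-Jewett in word form. -/
theorem HJ (a D : ℕ) (κ : Type) [Finite κ] : ∃ n, ∀ c : List ℕ → κ, ∃ w, w.length = n ∧
    RG a w (a + D) ∧ ∃ r, ∀ q : List ℕ, (∀ l ∈ q, l < a) → q.length = D →
      c (w.map (sb a q)) = r := by
  obtain ⟨ι, _, hι⟩ := Combinatorics.Line.exists_mono_in_high_dimension (Fin D → Fin a) κ
  let e := (Fintype.equivFin ι).symm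
  let blk : (Fin D → Fin a) → List ℕ := fun f => List.ofFn fun i => (f i : ℕ)
  have hblk : ∀ f, ∀ l ∈ blk f, l < a := by
    intro f l hl
    simp only [blk, List.mem_ofFn] at hl
    obtain ⟨i, rfl⟩ := hl
    exact (f i).2
  refine ⟨Fintype.card ι * D, fun c => ?_⟩
  obtain ⟨l, r, hr⟩ := hι fun x => c (List.ofFn fun i => blk (x (e i))).flatten
  let ob : Option (Fin D → Fin a) → List ℕ := fun o => o.elim (List.range' a D) blk
  have hobl : ∀ o, (ob o).length = D := by
    rintro (_ | f) <;> simp [ob, blk]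
  let L : List (Option (Fin D → Fin a)) := List.ofFn fun i => l.idxFun (e i)
  have hw : (L.map ob).flatten.length = Fintype.card ι * D := by
    have : ∀ L : List (Option (Fin D → Fin a)), (L.map ob).flatten.length = L.length * D := by
      intro L
      induction L with
      | nil => simp
      | cons x L ih => 
        rw [List.map_cons, List.flatten_cons, List.length_append, ih, hobl, List.length_cons]; ring
    rw [this]; simp [L]
  have hR1 : ∀ L : List (Option (Fin D → Fin a)), RG (a+D) (L.map ob).flatten (a+D) := by
    intro L
    apply RG_const
    intro x hx
    simp only [List.mem_flatten, List.mem_map] at hx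
    obtain ⟨_, ⟨o, _, rfl⟩, hx⟩ := hx
    rcases o with _ | f
    · simp [ob] at hx; omega
    · have := hblk f x hx; omega
  have hR2 : ∀ L : List (Option (Fin D → Fin a)), none ∈ L → RG a (L.map ob).flatten (a+D) := by
    intro L
    induction L with
    | nil => simp
    | cons x L ih =>
      intro hx
      rw [List.map_cons, List.flatten_cons]
      rcases x with _ | f
      · exact RG_append _ _ _ _ _ (RG_range' D a) (hR1 L)
      · exact RG_append _ _ _ _ _ (RG_const _ _ (hblk f)) (ih (by simpa using hx))
  refine ⟨(L.map ob).flatten, hw, hR2 L ?_, r, ?_⟩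
  · obtain ⟨i, hi⟩ := l.proper
    simp only [L, List.mem_ofFn]
    exact ⟨e.symm i, by simpa using hi⟩
  · intro q hq hqD
    let f : Fin D → Fin a := fun i => ⟨q[i.1]'(by omega), hq _ (List.getElem_mem _)⟩
    rw [← hr f]
    congr 1
    rw [List.map_flatten, List.map_map]
    congr 1
    simp only [L, List.map_ofFn]
    congr 1
    funext i
    simp only [Function.comp]
    have hc : ∀ g, (blk g).map (sb a q) = blk g := by
      intro g
      conv_rhs => rw [← List.map_id (blk g)]
      apply List.map_congr_left
      intro x hx
      simp [sb, hblk g x hx]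
    rcases h : l.idxFun (e i) with _ | g
    · have : l f (e i) = f := by simp [h]
      rw [this]
      apply List.ext_getElem
      · simp [ob, blk]
      · intro j h1 h2
        have h3 : j < D := by simpa [ob] using h1
        simp [ob, blk, sb, f, hqD, h3]
    · have : l f (e i) = g := by simp [h]
      rw [this]
      exact hc g

theorem stepP (a : ℕ) (ha : 0 < a) (N : ℕ) : ∀ (κ : Type) [Finite κ], ∃ M, ∀ c : List ℕ → κ,
    ∃ w, w.length = M ∧ RG a w (a + N) ∧ ∀ q₁ q₂ t₁ t₂ : List ℕ, (∀ l ∈ q₁, l < a) →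
      (∀ l ∈ q₂, l < a) → q₁.length = q₂.length → q₁.length + 1 + t₁.length = N →
      q₂.length + 1 + t₂.length = N →
      c (tw a (w.map (sb a (q₁ ++ a :: t₁)))) = c (tw a (w.map (sb a (q₂ ++ a :: t₂)))) := by
  induction N with
  | zero =>
    intro κ _
    exact ⟨0, fun c => ⟨[], rfl, by simp [RG], fun q₁ q₂ t₁ t₂ _ _ _ h => by omega⟩⟩
  | succ N ih =>
    intro κ _
    obtain ⟨D, hD⟩ := ih κ
    obtain ⟨H, hH⟩ := HJ a D κ
    refine ⟨H + 1, fun c => ?_⟩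
    obtain ⟨u, hu1, hu2, r, hu3⟩ := hH c
    obtain ⟨w, hw1, hw2, hw3⟩ := hD fun p => c (tw a (u.map (sb a (p ++ [a]))))
    have hRuw : RG a (u.map (sb a w)) (a + N) := RG_sub u a _ w (by rw [hw1]; exact hu2) hw2
    refine ⟨u.map (sb a w) ++ [a + N], by simp [hu1], ?_, ?_⟩
    · exact RG_append _ _ _ _ _ hRuw (Or.inr ⟨rfl, by simp [RG]; omega⟩)
    · -- key facts
      have key1 : ∀ q t : List ℕ, (∀ l ∈ q, l < a) → q.length = N → 
          c (tw a ((u.map (sb a w) ++ [a + N]).map (sb a (q ++ a :: t)))) = r := by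
        intro q t hq hqN
        have e1 : w.map (sb a (q ++ a :: t)) = w.map (sb a q) := by
          apply List.map_congr_left
          intro l hl
          have := RG_lt _ _ _ hw2 l hl
          by_cases hla : l < a
          · simp [sb, hla]
          · simp only [sb, hla, if_false]
            exact List.getD_append _ _ _ _ (by omega)
        have hwq : RG a (w.map (sb a q)) a := RG_sub w a a q (by rw [hqN]; exact hw2) (RG_const _ _ hq)
        have huq : RG a (u.map (sb a (w.map (sb a q)))) a :=
          RG_sub u a a _ (by simpa [hw1] using hu2) hwq
        rw [List.map_append, sub_assoc a ha, e1]
        have : [a + N].map (sb a (q ++ a :: t)) = [a] := by simp [sb, ← hqN]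
        rw [this, tw_append a _ _ (RG_lt _ _ _ huq)]
        exact hu3 _ (RG_lt _ _ _ hwq) (by simpa using hw1)
      have key2 : ∀ q t t' : List ℕ, (∀ l ∈ q, l < a) → q.length < N →
          q.length + 1 + t'.length = N →
          c (tw a ((u.map (sb a w) ++ [a + N]).map (sb a (q ++ a :: t)))) =
          c (tw a (u.map (sb a ((tw a (w.map (sb a (q ++ a :: t')))) ++ [a])))) := by
        intro q t t' hq hqN ht'
        rw [tw_sub a (u.map (sb a w) ++ [a + N]) q t (List.replicate t'.length 0) (a + N + 1) hq
          (RG_append _ _ _ _ _ hRuw (Or.inr ⟨rfl, by simp [RG]⟩)),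
          tw_sub a w q t' (List.replicate t'.length 0) (a + N) hq hw2]
        set v := q ++ a :: List.replicate t'.length 0 with hv
        have hvR : RG a v (a + 1) :=
          RG_append _ _ _ _ _ (RG_const _ _ hq) (Or.inr ⟨rfl, RG_const _ _ (by
            intro l hl; have := List.eq_of_mem_replicate hl; omega)⟩)
        have hvl : v.length = N := by simp [hv]; omega
        have hwv : RG a (w.map (sb a v)) (a + 1) := RG_sub w a _ v (by rw [hvl]; exact hw2) hvR
        obtain ⟨p, s, hps, hp, hs⟩ := RG_decomp _ _ _ hwv (by omega)
        have huv : RG a (u.map (sb a (w.map (sb a v)))) (a + 1) :=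
          RG_sub u a _ _ (by simpa [hw1] using hu2) hwv
        obtain ⟨p', s', hps', hp', hs'⟩ := RG_decomp _ _ _ huv (by omega)
        rw [List.map_append, sub_assoc a ha, hps', List.append_assoc, List.cons_append,
          tw_append a _ _ hp']
        rw [hps] at hps' ⊢
        rw [tw_append a _ _ hp, tw_sub a u p [] s _ hp hu2, hps', tw_append a _ _ hp']
      intro q₁ q₂ t₁ t₂ hq₁ hq₂ hqq h1 h2
      by_cases hN : q₁.length = N
      · rw [key1 q₁ t₁ hq₁ hN, key1 q₂ t₂ hq₂ (by omega)]
      · have hr : q₁.length + 1 + (List.replicate (N - q₁.length - 1) 0).length = N := by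
          simp; omega
        rw [key2 q₁ t₁ _ hq₁ (by omega) hr, key2 q₂ t₂ _ hq₂ (by omega) (hqq ▸ hr)]
        exact hw3 _ _ _ _ hq₁ hq₂ hqq hr (hqq ▸ hr)

def GR (a k : ℕ) : Prop := ∀ (m : ℕ) (κ : Type) [Finite κ], ∃ n, ∀ c : List ℕ → κ,
    ∃ w, w.length = n ∧ RG a w (a + m) ∧ ∃ r, ∀ v, v.length = m → RG a v (a + k) →
      c (w.map (sb a v)) = r

theorem stepT (a k : ℕ) (ha : 0 < a) (hG : GR (a+1) k) (M : ℕ) : ∀ (κ : Type) [Finite κ],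
    ∃ n, ∀ c : List ℕ → κ, ∃ w, w.length = n ∧ RG a w (a + M) ∧
      ∀ p t₁ t₂ : List ℕ, (∀ l ∈ p, l < a) → p.length + 1 + t₁.length = M →
      p.length + 1 + t₂.length = M → RG (a+1) t₁ (a + 1 + k) → RG (a+1) t₂ (a + 1 + k) →
      c (w.map (sb a (p ++ a :: t₁))) = c (w.map (sb a (p ++ a :: t₂))) := by
  induction M with
  | zero =>
    intro κ _
    exact ⟨0, fun c => ⟨[], rfl, by simp [RG], fun p t₁ t₂ _ h => by omega⟩⟩
  | succ M ih =>
    intro κ _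
    obtain ⟨m, hm⟩ := ih (Fin a → κ)
    obtain ⟨n, hn⟩ := hG m κ
    refine ⟨n + 1, fun c => ?_⟩
    obtain ⟨s, hs1, hs2, r, hs3⟩ := hn fun z => c (a :: z)
    obtain ⟨w, hw1, hw2, hw3⟩ := hm fun v p0 => c ((a :: s).map (sb a (p0.1 :: v)))
    have hsh : RG (a+1) (w.map (sh a)) (a + 1 + M) := by
      have := RG_shift a w a _ hw2 le_rfl
      rwa [show a + M + 1 = a + 1 + M by omega] at this
    refine ⟨a :: s.map (sb (a+1) (w.map (sh a))), by simp [hs1], Or.inr ⟨rfl, ?_⟩, ?_⟩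
    · rw [show a + (M + 1) = a + 1 + M by omega]
      exact RG_sub _ _ _ _ (by simpa [hw1] using hs2) hsh
    · have key1 : ∀ t, 1 + t.length = M + 1 → RG (a+1) t (a + 1 + k) →
          c ((a :: s.map (sb (a+1) (w.map (sh a)))).map (sb a (a :: t))) = r := by
        intro t ht htR
        have e1 : sb a (a :: t) = sb (a+1) t := by
          funext l
          rcases lt_trichotomy l a with h | h | h
          · simp [sb, h, Nat.lt_succ_of_lt h]
          · simp [sb, h]
          · have h1 : ¬ l < a := by omega
            have h2 : ¬ l < a + 1 := by omega
            simp only [sb, h1, h2, if_false]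
            rw [show l - a = (l - (a + 1)) + 1 by omega]; simp
        rw [List.map_cons, e1, sub_assoc (a+1) (by omega)]
        have e2 : sb (a+1) t a = a := by simp [sb]
        rw [e2]
        exact hs3 _ (by simpa using hw1) (RG_sub _ _ _ _ (by
          rw [show t.length = M by omega]; exact hsh) htR)
      have key2 : ∀ (p0 : ℕ) (v : List ℕ),
          (a :: s.map (sb (a+1) (w.map (sh a)))).map (sb a (p0 :: v)) =
          (a :: s).map (sb a (p0 :: (w.map (sb a v)))) := by
        intro p0 v
        rw [List.map_cons, List.map_cons, List.map_map]
        congr 1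
        · simp [sb]
        apply List.map_congr_left
        intro l _
        simp only [Function.comp]
        rcases lt_trichotomy l a with h | h | h
        · simp [sb, h, Nat.lt_succ_of_lt h]
        · simp [sb, h]
        · have h1 : ¬ l < a := by omega
          have h2 : ¬ l < a + 1 := by omega
          have e1 : sb (a+1) (w.map (sh a)) l = sh a (w.getD (l - (a+1)) 0) := by
            simp only [sb, h2, if_false]
            have : sh a 0 = 0 := by simp [sh, ha]
            conv_lhs => rw [← this]
            rw [List.getD_map]
          have e2 : sb a (p0 :: w.map (sb a v)) l = sb a v (w.getD (l - (a+1)) 0) := by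
            have : sb a v 0 = 0 := by simp [sb, ha]
            rw [← List.getD_map (f := sb a v), this]
            simp only [sb, h1, if_false]
            rw [show l - a = (l - (a + 1)) + 1 by omega]; simp
          rw [e1, e2]
          generalize w.getD (l - (a+1)) 0 = x
          by_cases hx : x < a
          · simp [sb, sh, hx]
          · have : ¬ x + 1 < a := by omega
            simp only [sb, sh, hx, if_false, this]
            rw [show x + 1 - a = (x - a) + 1 by omega]; simp
      intro p t₁ t₂ hp h1 h2 hR1 hR2
      cases p with
      | nil => 
        simp only [List.nil_append]
        rw [key1 t₁ (by simpa using h1) hR1, key1 t₂ (by simpa using h2) hR2]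
      | cons p0 p =>
        simp only [List.cons_append]
        rw [key2, key2]
        have := hw3 p t₁ t₂ (fun l hl => hp l (by simp [hl])) (by simp at h1; omega)
          (by simp at h2; omega) hR1 hR2
        exact congrFun this ⟨p0, hp p0 (by simp)⟩

theorem select (a : ℕ) (ha : 0 < a) (S : ℕ → Prop) [DecidablePred S] : ∀ (N m : ℕ),
    m ≤ ((Finset.range N).filter S).card → ∃ w, w.length = N ∧ RG a w (a + m) ∧
      ∀ q l t, w = q ++ l :: t → a ≤ l → S q.length := by
  intro N
  induction N with
  | zero => 
    intro m hm
    simp at hm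
    exact ⟨[], rfl, by simp [RG, hm], by simp⟩
  | succ N ih =>
    intro m hm
    have happ : ∀ (w : List ℕ) x, w.length = N → (∀ q l t, w = q ++ l :: t → a ≤ l → S q.length) →
        (a ≤ x → S N) → ∀ q l t, w ++ [x] = q ++ l :: t → a ≤ l → S q.length := by
      intro w x hw h hx q l t he hl
      rcases List.eq_nil_or_concat t with rfl | ⟨t', y, rfl⟩
      · have := List.append_inj' he (by simp)
        obtain ⟨rfl, h2⟩ := this
        simp at h2
        subst h2
        rw [hw]; exact hx hl
      · have he' : w ++ [x] = (q ++ l :: t') ++ [y] := by simpa using he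
        exact h q l t' (List.append_inj' he' (by simp)).1 hl
    by_cases hm' : m ≤ ((Finset.range N).filter S).card
    · obtain ⟨w, h1, h2, h3⟩ := ih m hm'
      refine ⟨w ++ [0], by simp [h1], RG_append _ _ _ _ _ h2 (Or.inl ⟨by omega, by simp [RG]⟩), 
        happ w 0 h1 h3 (by omega)⟩
    · rw [Finset.range_add_one, Finset.filter_insert] at hm
      split_ifs at hm with hS
      · have := Finset.card_insert_le N ((Finset.range N).filter S)
        obtain ⟨m', rfl⟩ : ∃ m', m = m' + 1 := ⟨m - 1, by omega⟩
        obtain ⟨w, h1, h2, h3⟩ := ih m' (by omega)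
        refine ⟨w ++ [a + m'], by simp [h1], 
          RG_append _ _ _ _ _ h2 (Or.inr ⟨rfl, by simp [RG]; omega⟩), happ w _ h1 h3 fun _ => hS⟩
      · omega

theorem graham_rothschild (k : ℕ) : ∀ a, 0 < a → GR a k := by
  induction k with
  | zero =>
    intro a ha m κ _
    obtain ⟨n, hn⟩ := HJ a m κ
    refine ⟨n, fun c => ?_⟩
    obtain ⟨w, h1, h2, r, h3⟩ := hn c
    exact ⟨w, h1, h2, r, fun v hv hR => h3 v (RG_lt _ _ _ hR) hv⟩
  | succ k ih =>
    intro a ha m κ _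
    classical
    have := Fintype.ofFinite κ
    set N := Fintype.card κ * m with hN
    obtain ⟨M, hM⟩ := stepP a ha N κ
    obtain ⟨n, hn⟩ := stepT a k ha (ih (a+1) (by omega)) M κ
    refine ⟨n, fun c => ?_⟩
    obtain ⟨w₁, h11, h12, h13⟩ := hn c
    let Q : List ℕ → List ℕ → Prop := fun p t => p.length + 1 + t.length = M ∧ RG (a+1) t (a+1+k)
    let c' : List ℕ → κ := fun p => 
      c (w₁.map (sb a (p ++ a :: (if h : ∃ t, Q p t then h.choose else []))))
    have hc' : ∀ p t, (∀ l ∈ p, l < a) → Q p t → c (w₁.map (sb a (p ++ a :: t))) = c' p := by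
      intro p t hp hQ
      have h : ∃ t, Q p t := ⟨t, hQ⟩
      simp only [c', h, dif_pos]
      exact h13 p t _ hp hQ.1 h.choose_spec.1 hQ.2 h.choose_spec.2
    obtain ⟨w₂, h21, h22, h23⟩ := hM c'
    let col : ℕ → κ := fun i => c' (tw a (w₂.map (sb a (List.replicate i 0 ++ a ::
      List.replicate (N - i - 1) 0))))
    have : Nonempty κ := ⟨c []⟩
    obtain ⟨r, -, hr⟩ := Finset.exists_le_card_fiber_of_mul_le_card_of_maps_to (s := Finset.range N)
      (t := (Finset.univ : Finset κ)) (f := col) (n := m) (by simp) (by simp) (by simp [hN])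
    obtain ⟨w₃, h31, h32, h33⟩ := select a ha (fun i => col i = r) N m hr
    have h23R : RG a (w₂.map (sb a w₃)) (a + m) := RG_sub _ _ _ _ (by rw [h31]; exact h22) h32
    refine ⟨w₁.map (sb a (w₂.map (sb a w₃))), by simp [h11], 
      RG_sub _ _ _ _ (by simpa [h21] using h12) h23R, r, ?_⟩
    intro v hv hvR
    rw [sub_assoc a ha, sub_assoc a ha]
    have hz : RG a (w₃.map (sb a v)) (a + (k + 1)) := RG_sub _ _ _ _ (by rw [hv]; exact h32) hvR
    have hz2 : RG a (w₂.map (sb a (w₃.map (sb a v)))) (a + (k + 1)) :=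
      RG_sub _ _ _ _ (by simpa [h31] using h22) hz
    obtain ⟨q, t, hqt, hq, ht⟩ := RG_decomp _ _ _ hz (by omega)
    obtain ⟨p, s, hps, hp, hs⟩ := RG_decomp _ _ _ hz2 (by omega)
    have hl1 : q.length + 1 + t.length = N := by
      have := congrArg List.length hqt
      simp [h31] at this; omega
    have hl2 : p.length + 1 + s.length = M := by
      have := congrArg List.length hps
      simp [h21] at this; omega
    rw [hps, hc' p s hp ⟨hl2, by rwa [show a + 1 + k = a + (k + 1) by omega]⟩]
    have e1 : p = tw a (w₂.map (sb a (q ++ a :: t))) := by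
      rw [← hqt, hps, tw_append _ _ _ hp]
    rw [e1]
    have hS : col q.length = r := by
      obtain ⟨q', t', hw3, hq', ht'⟩ := List.map_eq_append_iff.1 hqt
      obtain ⟨l, t'', rfl, hl, ht''⟩ := List.map_eq_cons_iff.1 ht'
      have := h33 q' l t'' hw3 (by
        by_contra hla
        simp only [sb, not_le.1 hla, if_true] at hl
        omega)
      rw [← hq']; simpa using this
    rw [← hS]
    refine h23 _ _ _ _ hq ?_ (by simp) hl1 (by simp; omega)
    intro l hl
    have := List.eq_of_mem_replicate hl
    omega

theorem RG_of : ∀ (v : List ℕ) (a b : ℕ), a ≤ b → (∀ l ∈ v, l < b) →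
    (∀ c, a ≤ c → c < b → c ∈ v) →
    (∀ p l t, v = p ++ l :: t → ∀ c, a ≤ c → c < l → c ∈ p) → RG a v b
  | [], a, b, hab, h1, h2, h3 => by
    by_contra h
    simp only [RG] at h
    simpa using h2 a le_rfl (by omega)
  | l :: v, a, b, hab, h1, h2, h3 => by
    have hl : l ≤ a := by
      by_contra h
      simpa using h3 [] l v rfl a le_rfl (by omega)
    rcases hl.lt_or_eq with hl | rfl
    · refine Or.inl ⟨hl, RG_of v a b hab (fun x hx => h1 x (by simp [hx])) ?_ ?_⟩
      · intro c hc hcb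
        rcases List.mem_cons.1 (h2 c hc hcb) with h | h
        · omega
        · exact h
      · intro p x t hv c hc hcx
        rcases List.mem_cons.1 (h3 (l :: p) x t (by simp [hv]) c hc hcx) with h | h
        · omega
        · exact h
    · refine Or.inr ⟨rfl, RG_of v _ b (h1 l (by simp)) (fun x hx => h1 x (by simp [hx])) ?_ ?_⟩
      · intro c hc hcb
        rcases List.mem_cons.1 (h2 c (by omega) hcb) with h | h
        · omega
        · exact h
      · intro p x t hv c hc hcx
        rcases List.mem_cons.1 (h3 (l :: p) x t (by simp [hv]) c (by omega) hcx) with h | h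
        · omega
        · exact h

theorem RG_mem : ∀ (v : List ℕ) (a b : ℕ), RG a v b → ∀ c, a ≤ c → c < b → c ∈ v
  | [], a, b, h, c, h1, h2 => by simp only [RG] at h; omega
  | l :: v, a, b, h, c, h1, h2 => by
    rcases h with ⟨h3, h⟩ | ⟨h3, h⟩
    · exact List.mem_cons_of_mem _ (RG_mem v a b h c h1 h2)
    · by_cases hc : c = l
      · simp [hc]
      · exact List.mem_cons_of_mem _ (RG_mem v _ b h c (by omega) h2)

theorem RG_first : ∀ (v : List ℕ) (a b : ℕ), RG a v b → ∀ j (hj : j < v.length) c, a ≤ c →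
    c < v[j] → ∃ i, ∃ hi : i < j, v[i] = c
  | [], a, b, h, j, hj, c, h1, h2 => by simp at hj
  | l :: v, a, b, h, 0, hj, c, h1, h2 => by
    simp at h2
    rcases h with ⟨h3, h⟩ | ⟨h3, h⟩ <;> omega
  | l :: v, a, b, h, j+1, hj, c, h1, h2 => by
    simp at h2 hj
    rcases h with ⟨h3, h⟩ | ⟨h3, h⟩
    · obtain ⟨i, hi, e⟩ := RG_first v a b h j hj c h1 h2
      exact ⟨i+1, by omega, by simpa using e⟩
    · by_cases hc : c = l
      · exact ⟨0, by omega, by simp [hc]⟩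
      · obtain ⟨i, hi, e⟩ := RG_first v _ b h j hj c (by omega) h2
        exact ⟨i+1, by omega, by simpa using e⟩

structure Enum {X : Type} [LinearOrder X] [Fintype X] (P : X → X → Prop) (K : ℕ)
    (en : ℕ → X → Bool) : Prop where
  up : ∀ l x y, P x y → en l x ≤ en l y
  zero : ∀ x, en 0 x = false
  surj : ∀ D : X → Bool, (∀ x y, P x y → D x ≤ D y) → ∃ l < 1 + K, en l = D
  mono : ∀ l l', l < 1 + K → l' < 1 + K → (l < l' ↔ toLex (en l) < toLex (en l'))

theorem exists_enum {X : Type} [LinearOrder X] [Fintype X] (P : X → X → Prop) :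
    ∃ K en, Enum P K en := by
  classical
  let U := {D : Lex (X → Bool) // ∀ x y, P x y → ofLex D x ≤ ofLex D y}
  have : Finite (Lex (X → Bool)) := inferInstanceAs (Finite (X → Bool))
  have : Fintype U := Fintype.ofFinite U
  let bot : U := ⟨toLex fun _ => false, fun x y _ => le_rfl⟩
  have hbot : ∀ D : U, bot ≤ D := by
    intro D
    have : toLex (fun _ => false) ≤ toLex (ofLex D.1) := 
      Pi.toLex_monotone (fun x => Bool.false_le _)
    exact this
  have hpos : 0 < Fintype.card U := Fintype.card_pos_iff.2 ⟨bot⟩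
  let e : Fin (Fintype.card U) ≃o U := Fintype.orderIsoFinOfCardEq U rfl
  have hK : 1 + (Fintype.card U - 1) = Fintype.card U := by omega
  refine ⟨Fintype.card U - 1, 
    fun l => if h : l < Fintype.card U then ofLex (e ⟨l, h⟩).1 else fun _ => false, ?_, ?_, ?_, ?_⟩
  · intro l x y h
    split_ifs with h'
    · exact (e ⟨l, h'⟩).2 x y h
    · exact le_rfl
  · intro x
    simp only [hpos, dif_pos]
    have : e ⟨0, hpos⟩ = bot := by
      apply le_antisymm _ (hbot _)
      rw [← e.le_symm_apply]
      exact Fin.mk_le_of_le_val (Nat.zero_le _)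
    rw [this]; rfl
  · intro D hD
    refine ⟨(e.symm ⟨toLex D, hD⟩).1, by rw [hK]; exact (e.symm ⟨toLex D, hD⟩).2, ?_⟩
    have h1 := e.apply_symm_apply ⟨toLex D, hD⟩
    simp only [Fin.is_lt, dif_pos, Fin.eta]
    rw [h1]; rfl
  · intro l l' hl hl'
    rw [hK] at hl hl'
    simp only [hl, hl', dif_pos]
    have : (⟨l, hl⟩ : Fin (Fintype.card U)) < ⟨l', hl'⟩ ↔ _ := (e.lt_iff_lt).symm
    exact this

def Ph {X : Type} (en : ℕ → X → Bool) (n : ℕ) (w : List ℕ) (x : X) : Lex (Fin n → Bool) :=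
  toLex fun j => en (w.getD j 0) x

section
variable {X : Type} [LinearOrder X] [Fintype X] {P : X → X → Prop}
  (htr : ∀ x y z, P x y → P y z → P x z) (hext : ∀ x y, P x y → x < y)

theorem Enum.prin {K : ℕ} {en : ℕ → X → Bool} (h : Enum P K en)
    (htr : ∀ x y z, P x y → P y z → P x z) (y : X) :
    ∃ l, 1 ≤ l ∧ l < 1 + K ∧ ∀ z, en l z = true ↔ (z = y ∨ P y z) := by
  classical
  obtain ⟨l, hl, e⟩ := h.surj (fun z => decide (z = y ∨ P y z)) (by
    intro x z hxz
    rw [Bool.le_iff_imp]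
    simp only [decide_eq_true_eq]
    rintro (rfl | h)
    · exact Or.inr hxz
    · exact Or.inr (htr _ _ _ h hxz))
  refine ⟨l, ?_, hl, fun z => by simp [e]⟩
  by_contra hl0
  have : l = 0 := by omega
  subst this
  have h1 := h.zero y
  simp [e] at h1

theorem emb_P {K : ℕ} {en : ℕ → X → Bool} (h : Enum P K en)
    (htr : ∀ x y z, P x y → P y z → P x z) (hext : ∀ x y, P x y → x < y)
    (n : ℕ) (w : List ℕ) (hw : w.length = n) (hR : RG 1 w (1 + K)) (x y : X) :
    P x y ↔ ofLex (Ph en n w x) < ofLex (Ph en n w y) := by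
  have hocc : ∀ z : X, ∃ j : Fin n, ∀ t, ofLex (Ph en n w t) j = true ↔ (t = z ∨ P z t) := by
    intro z
    obtain ⟨l, h1, h2, h3⟩ := h.prin htr z
    obtain ⟨j, hj, e⟩ := List.getElem_of_mem (RG_mem w _ _ hR l h1 h2)
    refine ⟨⟨j, by omega⟩, fun t => ?_⟩
    rw [← h3 t]
    simp [Ph, hj, e]
  constructor
  · intro hxy
    refine lt_of_le_not_ge (fun j => h.up _ _ _ hxy) fun hle => ?_
    obtain ⟨j, hj⟩ := hocc y
    have h1 := (hj y).2 (Or.inl rfl)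
    have h2 := (hj x).1 (Bool.le_iff_imp.1 (hle j) h1)
    have h3 := hext _ _ hxy
    rcases h2 with rfl | h2
    · exact lt_irrefl _ h3
    · exact lt_asymm h3 (hext _ _ h2)
  · intro hlt
    obtain ⟨j, hj⟩ := hocc x
    rcases (hj y).1 (Bool.le_iff_imp.1 (hlt.le j) ((hj x).2 (Or.inl rfl))) with rfl | h
    · exact absurd hlt (lt_irrefl _)
    · exact h

theorem emb_L {K : ℕ} {en : ℕ → X → Bool} (h : Enum P K en)
    (htr : ∀ x y z, P x y → P y z → P x z) (hext : ∀ x y, P x y → x < y)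
    (n : ℕ) (w : List ℕ) (hw : w.length = n) (hR : RG 1 w (1 + K)) :
    StrictMono (Ph en n w) := by
  intro x y hxy
  obtain ⟨l, h1, h2, h3⟩ := h.prin htr y
  have hly : en l y = true := (h3 y).2 (Or.inl rfl)
  have hlt : ∀ z, z < y → en l z = false := by
    intro z hz
    rw [← Bool.not_eq_true, h3]
    rintro (rfl | h')
    · exact lt_irrefl _ hz
    · exact lt_asymm hz (hext _ _ h')
  rcases lt_trichotomy (Ph en n w x) (Ph en n w y) with hc | hc | hc
  · exact hc
  · exfalso
    obtain ⟨j, hj, e⟩ := List.getElem_of_mem (RG_mem w _ _ hR l h1 h2)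
    have := congrFun (congrArg ofLex hc) ⟨j, by omega⟩
    simp [Ph, hj, e, hly, hlt x hxy] at this
  · exfalso
    obtain ⟨j, hj1, hj2⟩ := hc
    have hjw : j.1 < w.length := by have := j.2; omega
    have e1 : ∀ t, Ph en n w t j = en w[j.1] t := by
      intro t
      change en (w.getD j 0) t = _
      simp [hjw]
    rw [e1, e1, Bool.lt_iff] at hj2
    have hlj : l < w[j.1] := by
      rw [h.mono l _ h2 (RG_lt _ _ _ hR _ (List.getElem_mem _))]
      rcases lt_trichotomy (toLex (en l)) (toLex (en w[j.1])) with hc | hc | hc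
      · exact hc
      · have := congrFun (toLex.injective hc) y
        rw [hly, hj2.1] at this; cases this
      · exfalso
        obtain ⟨i, hi1, hi2⟩ := hc
        change ∀ j' < i, en w[j.1] j' = en l j' at hi1
        change en w[j.1] i < en l i at hi2
        rw [Bool.lt_iff] at hi2
        have hiy : y ≤ i := by
          by_contra hh
          rw [hlt i (not_le.1 hh)] at hi2
          simp at hi2
        have := hi1 x (lt_of_lt_of_le hxy hiy)
        rw [hlt x hxy, hj2.2] at this; cases this
    obtain ⟨i, hi, e⟩ := RG_first w _ _ hR j hjw l h1 hlj
    have := hj1 ⟨i, by omega⟩ hi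
    change en (w.getD i 0) y = en (w.getD i 0) x at this
    have hiw : i < w.length := by omega
    simp [hiw, e, hly, hlt x hxy] at this

end

theorem pull {X Y : Type} [LinearOrder X] [Fintype X] [LinearOrder Y] [Fintype Y]
    {P : X → X → Prop} {Q : Y → Y → Prop} {K M : ℕ} {en : ℕ → X → Bool} {em : ℕ → Y → Bool}
    (h : Enum P K en) (h' : Enum Q M em) 
    (htr : ∀ x y z, Q x y → Q y z → Q x z) (hext : ∀ x y, Q x y → x < y)
    (f : X → Y) (hP : ∀ x y, P x y ↔ Q (f x) (f y)) (hf : StrictMono f) :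
    ∃ v, v.length = M ∧ RG 1 v (1 + K) ∧ ∀ l < 1 + M, ∀ x, en (sb 1 v l) x = em l (f x) := by
  classical
  have hg : ∀ l, ∃ g < 1 + K, en g = em l ∘ f := fun l =>
    h.surj (em l ∘ f) fun x y hxy => h'.up l _ _ ((hP x y).1 hxy)
  choose g hgK hg using hg
  -- upward closure
  have hup : ∀ c, 1 ≤ c → c < 1 + K → ∃ l, 1 ≤ l ∧ l < 1 + M ∧ 
      (∀ y, em l y = true ↔ ∃ d, en c d = true ∧ (y = f d ∨ Q (f d) y)) ∧ g l = c := by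
    intro c hc1 hcK
    obtain ⟨l, hl, e⟩ := h'.surj (fun y => decide (∃ d, en c d = true ∧ (y = f d ∨ Q (f d) y))) (by
      intro x z hxz
      rw [Bool.le_iff_imp]
      simp only [decide_eq_true_eq]
      rintro ⟨d, hd, rfl | h⟩
      · exact ⟨d, hd, Or.inr hxz⟩
      · exact ⟨d, hd, Or.inr (htr _ _ _ h hxz)⟩)
    have hem : ∀ y, em l y = true ↔ ∃ d, en c d = true ∧ (y = f d ∨ Q (f d) y) := by
      intro y; simp [e]
    have hgc : en (g l) = en c := by
      funext x
      rw [hg, Bool.eq_iff_iff]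
      simp only [Function.comp]
      rw [hem]
      constructor
      · rintro ⟨d, hd, hx | hx⟩
        · rw [hf.injective hx]; exact hd
        · exact Bool.le_iff_imp.1 (h.up c _ _ ((hP _ _).2 hx)) hd
      · intro hx
        exact ⟨x, hx, Or.inl rfl⟩
    have hgc' : g l = c := by
      have h1 := h.mono (g l) c (hgK l) hcK
      have h2 := h.mono c (g l) hcK (hgK l)
      rw [hgc] at h1 h2
      have h3 : ¬ g l < c := fun hh => lt_irrefl _ (h1.1 hh)
      have h4 : ¬ c < g l := fun hh => lt_irrefl _ (h2.1 hh)
      omega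
    refine ⟨l, ?_, hl, hem, hgc'⟩
    by_contra hl0
    have : l = 0 := by omega
    subst this
    have h0 : en (g 0) = en 0 := by
      funext x; rw [hg, h.zero]; exact h'.zero _
    have := (h.mono 0 c (by omega) hcK).1 (by omega)
    rw [← h0, hgc'] at this
    exact lt_irrefl _ this
  refine ⟨(List.range M).map (fun i => g (i+1)), by simp, RG_of _ _ _ (by omega) ?_ ?_ ?_, ?_⟩
  · intro l hl
    simp only [List.mem_map] at hl
    obtain ⟨i, _, rfl⟩ := hl
    exact hgK _
  · intro c hc1 hcK
    obtain ⟨l, hl1, hl2, _, hgl⟩ := hup c hc1 hcK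
    simp only [List.mem_map, List.mem_range]
    exact ⟨l - 1, by omega, by rw [show l - 1 + 1 = l by omega]; exact hgl⟩
  · intro p x t hv c hc1 hcx
    have hlen := congrArg List.length hv
    simp at hlen
    have hx : x = g (p.length + 1) := by
      have h1 : (p ++ x :: t).getD p.length 0 = x := by simp
      rw [← hv, List.getD_eq_getElem _ _ (by simp; omega)] at h1
      simpa using h1.symm
    have hp : ∀ i < p.length, g (i+1) ∈ p := by
      intro i hi
      have h1 : (p ++ x :: t).getD i 0 = p[i] := by
        rw [List.getD_append _ _ _ _ hi, List.getD_eq_getElem]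
      rw [← hv, List.getD_eq_getElem _ _ (by simp; omega)] at h1
      have h2 : g (i+1) = p[i] := by simpa using h1
      rw [h2]; exact List.getElem_mem _
    set i := p.length with hi
    have hcK : c < 1 + K := by have := hgK (i+1); omega
    obtain ⟨l, hl1, hl2, hem, hgl⟩ := hup c hc1 hcK
    suffices hlt : l < i + 1 by
      have := hp (l-1) (by omega)
      rw [show l - 1 + 1 = l by omega, hgl] at this
      exact this
    rw [h'.mono l (i+1) hl2 (by omega)]
    rcases lt_trichotomy (toLex (em l)) (toLex (em (i+1))) with hc | hc | hc
    · exact hc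
    · exfalso
      have h1 : en (g l) = en (g (i+1)) := by rw [hg, hg, toLex.injective hc]
      have h2 := (h.mono c x hcK (hx ▸ hgK _)).1 hcx
      rw [hx, ← h1, hgl] at h2
      exact lt_irrefl _ h2
    · exfalso
      obtain ⟨z, hz1, hz2⟩ := (h.mono c x hcK (hx ▸ hgK _)).1 hcx
      change ∀ j < z, en c j = en x j at hz1
      change en c z < en x z at hz2
      obtain ⟨e, he1, he2⟩ := hc
      change ∀ j < e, em (i+1) j = em l j at he1
      change em (i+1) e < em l e at he2
      rw [Bool.lt_iff] at hz2 he2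
      rw [hx] at hz1 hz2
      simp only [hg, Function.comp] at hz1 hz2
      obtain ⟨d, hd, hde⟩ := (hem e).1 he2.2
      have hfd : em (i+1) (f d) = false := by
        rw [← Bool.not_eq_true]
        intro hh
        rcases hde with rfl | hde
        · rw [hh] at he2; simp at he2
        · have := Bool.le_iff_imp.1 (h'.up (i+1) _ _ hde) hh
          rw [this] at he2; simp at he2
      have hzd : z < d := by
        rcases lt_trichotomy z d with hh | rfl | hh
        · exact hh
        · rw [hd] at hz2; simp at hz2
        · have := hz1 d hh
          rw [hd, hfd] at this; cases this
      have hfe : f z < e := by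
        have := hf hzd
        rcases hde with rfl | hde
        · exact this
        · exact this.trans (hext _ _ hde)
      have h3 := he1 _ hfe
      rw [hz2.2] at h3
      obtain ⟨d', hd', h4⟩ := (hem (f z)).1 h3.symm
      have : en c z = true := by
        rcases h4 with h4 | h4
        · rw [hf.injective h4]; exact hd'
        · exact Bool.le_iff_imp.1 (h.up c _ _ ((hP _ _).2 h4)) hd'
      rw [this] at hz2; simp at hz2
  · intro l hl x
    by_cases hl0 : l = 0
    · subst hl0
      simp [sb, h.zero, h'.zero]
    · have h1 : ¬ l < 1 := by omega
      have h2 : l - 1 < M := by omega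
      have : sb 1 ((List.range M).map (fun i => g (i+1))) l = g l := by
        simp only [sb, h1, if_false]
        rw [List.getD_eq_getElem _ _ (by simpa using h2)]
        simp [show l - 1 + 1 = l by omega]
      rw [this, hg]; rfl

structure PLS where
  car : Type
  fin : Fintype car
  P : car → car → Prop
  L : car → car → Prop
  hP : IsStrictOrder car P
  hL : IsStrictTotalOrder car L
  hext : ∀ x y, P x y → L x y

def PLS.Copy (A Z : PLS) (S : Set Z.car) : Prop := IsCopy A.P A.L Z.P Z.L S

def cube (n : ℕ) : PLS where
  car := Lex (Fin n → Bool)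
  fin := inferInstanceAs (Fintype (Fin n → Bool))
  P := fun x y => ofLex x < ofLex y
  L := fun x y => x < y
  hP := { irrefl := fun x => lt_irrefl (ofLex x), trans := fun _ _ _ h h' => lt_trans h h' }
  hL := inferInstance
  hext := fun _ _ h => Pi.toLex_strictMono h

theorem single (A B : PLS) (κ : Type) [Finite κ] : ∃ Z : PLS, ∀ χ : Set Z.car → κ,
    ∃ T, B.Copy Z T ∧ ∀ S₁ S₂, A.Copy Z S₁ ∧ S₁ ⊆ T → A.Copy Z S₂ ∧ S₂ ⊆ T → χ S₁ = χ S₂ := by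
  classical
  obtain ⟨X, _, PX, LX, hPX, hLX, hX⟩ := A
  obtain ⟨Y, _, PY, LY, hPY, hLY, hY⟩ := B
  let _ : LinearOrder X := linearOrderOfSTO LX
  let _ : LinearOrder Y := linearOrderOfSTO LY
  have htX : ∀ x y z, PX x y → PX y z → PX x z := fun x y z => hPX.trans x y z
  have htY : ∀ x y z, PY x y → PY y z → PY x z := fun x y z => hPY.trans x y z
  have hX' : ∀ x y, PX x y → x < y := hX
  have hY' : ∀ x y, PY x y → x < y := hY
  obtain ⟨K, en, hen⟩ := exists_enum PX
  obtain ⟨M, em, hem⟩ := exists_enum PY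
  obtain ⟨n, hn⟩ := graham_rothschild K 1 one_pos M κ
  refine ⟨cube n, fun χ => ?_⟩
  obtain ⟨w, hw, hR, r, hr⟩ := hn fun v => χ (Set.range (Ph en n v))
  have hmono := emb_L hem htY hY' n w hw hR
  have hPw := emb_P hem htY hY' n w hw hR
  refine ⟨Set.range (Ph em n w), ⟨Ph em n w, ⟨hPw, fun x y => hmono.lt_iff_lt.symm⟩, rfl⟩, ?_⟩
  suffices key : ∀ S, PLS.Copy ⟨X, _, PX, LX, hPX, hLX, hX⟩ (cube n) S ∧ S ⊆ Set.range (Ph em n w) → χ S = r by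
    intro S₁ S₂ h1 h2
    rw [key S₁ h1, key S₂ h2]
  rintro S ⟨⟨π, ⟨hπP, hπL⟩, rfl⟩, hS⟩
  have hf : ∀ x, ∃ y, Ph em n w y = π x := fun x => hS ⟨x, rfl⟩
  choose f hf using hf
  have hfL : StrictMono f := by
    intro x y hxy
    have := (hπL x y).1 hxy
    rw [← hf, ← hf] at this
    exact hmono.lt_iff_lt.1 this
  have hfP : ∀ x y, PX x y ↔ PY (f x) (f y) := by
    intro x y
    rw [hPw, hf, hf]; exact hπP x y
  obtain ⟨v, hv, hvR, hvx⟩ := pull hen hem htY hY' f hfP hfL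
  rw [← hr v hv hvR]
  congr 2
  funext x
  rw [← hf x]
  have : ∀ j : Fin n, em (w.getD j 0) (f x) = en ((w.map (sb 1 v)).getD j 0) x := by
    intro j
    have hj : j.1 < w.length := by have := j.2; omega
    rw [List.getD_eq_getElem _ _ hj, List.getD_eq_getElem _ _ (by simpa using hj), List.getElem_map]
    exact (hvx _ (RG_lt _ _ _ hR _ (List.getElem_mem _)) x).symm
  exact congrArg toLex (funext this)

theorem prod_ramsey : ∀ (k : ℕ) (A B : Fin k → PLS) (κ : Type) [Finite κ], ∃ Z : Fin k → PLS,
    ∀ χ : (∀ i, Set (Z i).car) → κ, ∃ T : ∀ i, Set (Z i).car, (∀ i, (B i).Copy (Z i) (T i)) ∧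
      ∀ S₁ S₂ : ∀ i, Set (Z i).car, (∀ i, (A i).Copy (Z i) (S₁ i) ∧ S₁ i ⊆ T i) →
        (∀ i, (A i).Copy (Z i) (S₂ i) ∧ S₂ i ⊆ T i) → χ S₁ = χ S₂
  | 0, A, B, κ, _ => ⟨A, fun χ => ⟨fun i => i.elim0, fun i => i.elim0, fun S₁ S₂ _ _ => by
      congr 1; funext i; exact i.elim0⟩⟩
  | k+1, A, B, κ, _ => by
    classical
    obtain ⟨Z', hZ'⟩ := prod_ramsey k (fun i => A i.succ) (fun i => B i.succ) κ
    have hfin : ∀ i, Finite (Z' i).car := fun i => @Finite.of_fintype _ (Z' i).fin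
    obtain ⟨Z0, hZ0⟩ := single (A 0) (B 0) ((∀ i, Set (Z' i).car) → κ)
    let Z : Fin (k+1) → PLS := Fin.cons Z0 Z'
    let mk : Set Z0.car → (∀ i, Set (Z' i).car) → ∀ i, Set (Z i).car := fun S0 S' =>
      Fin.cons (α := fun i => Set (Z i).car) S0 S'
    have hmk : ∀ S : ∀ i, Set (Z i).car, mk (S 0) (fun i => S i.succ) = S := by
      intro S
      funext i
      refine Fin.cases ?_ (fun i => ?_) i <;> rfl
    refine ⟨Z, fun χ => ?_⟩
    obtain ⟨T0, hT0, hm0⟩ := hZ0 fun S0 S' => χ (mk S0 S')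
    let Q : Set Z0.car → Prop := fun S => (A 0).Copy Z0 S ∧ S ⊆ T0
    let R : Set Z0.car := if h : ∃ S, Q S then h.choose else ∅
    have hR : ∀ S, Q S → Q R := by
      intro S hS
      have h : ∃ S, Q S := ⟨S, hS⟩
      simp only [R, h, dif_pos]
      exact h.choose_spec
    obtain ⟨T', hT', hm'⟩ := hZ' fun S' => χ (mk R S')
    refine ⟨mk T0 T', fun i => ?_, fun S₁ S₂ h1 h2 => ?_⟩
    · refine Fin.cases ?_ (fun i => ?_) i
      · exact hT0
      · exact hT' i
    · have q1 : Q (S₁ 0) := h1 0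
      have q2 : Q (S₂ 0) := h2 0
      have e1 := congrFun (hm0 (S₁ 0) R q1 (hR _ q1)) fun i => S₁ i.succ
      have e2 := congrFun (hm0 (S₂ 0) R q2 (hR _ q1)) fun i => S₂ i.succ
      have e3 := hm' (fun i => S₁ i.succ) (fun i => S₂ i.succ) (fun i => h1 i.succ) 
        (fun i => h2 i.succ)
      rw [hmk] at e1 e2
      rw [e1, e2, e3]

theorem ramsey_posets_product
    (k : ℕ) (hk : 0 < k)
    (X Y : Fin k → Type) (_ : ∀ i, Fintype (X i)) (_ : ∀ i, Fintype (Y i))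
    (PX LX : ∀ i, X i → X i → Prop) (PY LY : ∀ i, Y i → Y i → Prop)
    (hPX : ∀ i, IsStrictOrder (X i) (PX i))
    (hLX : ∀ i, IsStrictTotalOrder (X i) (LX i))
    (hXext : ∀ i x y, PX i x y → LX i x y)
    (hPY : ∀ i, IsStrictOrder (Y i) (PY i))
    (hLY : ∀ i, IsStrictTotalOrder (Y i) (LY i))
    (hYext : ∀ i x y, PY i x y → LY i x y) :
    ∃ (Z : Fin k → Type) (_ : ∀ i, Fintype (Z i)) (PZ LZ : ∀ i, Z i → Z i → Prop),
      (∀ i, IsStrictOrder (Z i) (PZ i)) ∧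
      (∀ i, IsStrictTotalOrder (Z i) (LZ i)) ∧
      (∀ i x y, PZ i x y → LZ i x y) ∧
      ∀ χ : (∀ i, Set (Z i)) → Fin 2,
        ∃ T : ∀ i, Set (Z i),
          (∀ i, IsCopy (PY i) (LY i) (PZ i) (LZ i) (T i)) ∧
          ∀ S₁ S₂ : ∀ i, Set (Z i),
            (∀ i, IsCopy (PX i) (LX i) (PZ i) (LZ i) (S₁ i) ∧ S₁ i ⊆ T i) →
            (∀ i, IsCopy (PX i) (LX i) (PZ i) (LZ i) (S₂ i) ∧ S₂ i ⊆ T i) →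
            χ S₁ = χ S₂ := by
  rename_i fX fY
  obtain ⟨Z, hZ⟩ := prod_ramsey k
    (fun i => ⟨X i, fX i, PX i, LX i, hPX i, hLX i, hXext i⟩)
    (fun i => ⟨Y i, fY i, PY i, LY i, hPY i, hLY i, hYext i⟩) (Fin 2)
  exact ⟨fun i => (Z i).car, fun i => (Z i).fin, fun i => (Z i).P, fun i => (Z i).L,
    fun i => (Z i).hP, fun i => (Z i).hL, fun i => (Z i).hext, hZ⟩
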